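/- The infinite sum over i ≥ 1 of 1/(i^4 · binom(2i, i)) equals 17π⁴/3240. -/

import Mathlib

open Real Finset

noncomputable section

def aa (k n : ℕ) : ℝ := ∏ j ∈ range k, 1 / ((n:ℝ) + j + 1)^2
def hh (k n : ℕ) : ℝ := ∑ j ∈ range k, 1 / ((n:ℝ) + j + 1)^2
def cc (k : ℕ) : ℝ := (Nat.centralBinom k : ℝ)
def ww (k : ℕ) : ℝ := ((Nat.factorial k : ℕ) : ℝ)^2 / cc k
def ee (k n : ℕ) : ℝ := ww k * aa (k+1) n * (hh (k+1) n - 4 * hh k 0)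
def gg (k n : ℕ) : ℝ :=
  ww k / (2 * (2 * k + 1)) * (2 * n + 3 * k + 3) * aa (k+1) n * (hh (k+1) n - 4 * hh k 0)

lemma cc_pos (k : ℕ) : 0 < cc k := by
  unfold cc; exact_mod_cast Nat.centralBinom_pos k

lemma cc_succ (k : ℕ) : cc (k+1) = cc k * (2 * (2 * k + 1)) / (k + 1) := by
  have h := Nat.succ_mul_centralBinom_succ k
  have h' : ((k:ℝ) + 1) * cc (k+1) = 2 * (2 * k + 1) * cc k := by
    unfold cc; exact_mod_cast h
  have : (k:ℝ) + 1 ≠ 0 := by positivity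
  field_simp
  linarith

lemma cc_ge (k : ℕ) : (2:ℝ)^k ≤ cc k := by
  induction k with
  | zero => simp [cc]
  | succ k ih =>
    rw [cc_succ, pow_succ, le_div_iff₀ (by positivity)]
    have := pow_pos (show (0:ℝ) < 2 by norm_num) k
    have hk : (0:ℝ) ≤ k := by positivity
    nlinarith [mul_le_mul_of_nonneg_right ih (show (0:ℝ) ≤ 2 * (2 * k + 1) by positivity), mul_nonneg this.le hk]

lemma tend_aux (a b : ℝ) :
    Filter.Tendsto (fun n : ℕ => (a * n + b) / cc n) Filter.atTop (nhds 0) := by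
  have h1 : Filter.Tendsto (fun n : ℕ => (n:ℝ)^1 / (2:ℝ)^n) Filter.atTop (nhds 0) :=
    tendsto_pow_const_div_const_pow_of_one_lt 1 (by norm_num)
  have h2 : Filter.Tendsto (fun n : ℕ => (n:ℝ)^0 / (2:ℝ)^n) Filter.atTop (nhds 0) :=
    tendsto_pow_const_div_const_pow_of_one_lt 0 (by norm_num)
  have h3 := (h1.const_mul |a|).add (h2.const_mul |b|)
  simp only [mul_zero, add_zero] at h3
  refine squeeze_zero_norm (fun n => ?_) h3
  rw [norm_div, Real.norm_eq_abs, Real.norm_eq_abs, abs_of_pos (cc_pos n)]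
  have h4 : |a * n + b| ≤ |a| * n + |b| := by
    refine (abs_add_le _ _).trans ?_
    rw [abs_mul, Nat.abs_cast]
  calc |a * n + b| / cc n ≤ (|a| * n + |b|) / 2^n := by
        gcongr
        exact cc_ge n
    _ = _ := by ring

lemma aa_succ (k n : ℕ) : aa (k+1) n = aa k n * (1 / ((n:ℝ) + k + 1)^2) := by
  simp only [aa, prod_range_succ]
lemma hh_succ (k n : ℕ) : hh (k+1) n = hh k n + 1 / ((n:ℝ) + k + 1)^2 := by
  simp [hh, sum_range_succ]
lemma aa_succ' (k n : ℕ) : aa (k+1) n = aa k (n+1) * (1 / ((n:ℝ) + 1)^2) := by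
  simp only [aa, prod_range_succ']
  congr 1
  · apply prod_congr rfl; intros; push_cast; ring
  · simp
lemma hh_succ' (k n : ℕ) : hh (k+1) n = hh k (n+1) + 1 / ((n:ℝ) + 1)^2 := by
  simp only [hh, sum_range_succ']
  congr 1
  · apply sum_congr rfl; intros; push_cast; ring
  · simp

lemma aa_shift (k n : ℕ) :
    aa k (n+1) = aa k n * ((n:ℝ) + 1)^2 / ((n:ℝ) + k + 1)^2 := by
  have h1 := aa_succ k n
  rw [aa_succ'] at h1
  have : (n:ℝ) + 1 ≠ 0 := by positivity
  have : (n:ℝ) + k + 1 ≠ 0 := by positivity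
  field_simp at h1 ⊢
  linarith
lemma hh_shift (k n : ℕ) :
    hh k (n+1) = hh k n + 1 / ((n:ℝ) + k + 1)^2 - 1 / ((n:ℝ) + 1)^2 := by
  have h1 := hh_succ k n
  rw [hh_succ'] at h1
  linarith

lemma ww_succ (k : ℕ) : ww (k+1) = ww k * (k+1)^3 / (2 * (2 * k + 1)) := by
  unfold ww
  rw [cc_succ, Nat.factorial_succ]
  have := (cc_pos k).ne'
  push_cast
  field_simp

lemma tele (k n : ℕ) : ee k n - ee (k+1) n = gg k n - gg k (n+1) := by
  unfold ee gg
  rw [aa_succ (k+1) n, hh_succ (k+1) n, aa_shift, hh_shift, hh_succ k 0, ww_succ]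
  generalize aa (k+1) n = A
  generalize hh (k+1) n = B
  generalize hh k 0 = C
  generalize ww k = W
  have h1 : (n:ℝ) + 1 ≠ 0 := by positivity
  have h2 : (n:ℝ) + (k + 1) + 1 ≠ 0 := by positivity
  have h3 : (k:ℝ) + 1 ≠ 0 := by positivity
  push_cast
  rw [zero_add]
  field_simp
  ring

lemma hh_nonneg (k n : ℕ) : 0 ≤ hh k n := by unfold hh; positivity
lemma aa_nonneg (k n : ℕ) : 0 ≤ aa k n := by unfold aa; positivity
lemma hh_le (k n : ℕ) : hh k n ≤ k := by
  induction k with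
  | zero => simp [hh]
  | succ k ih =>
    rw [hh_succ]
    have : 1 / ((n:ℝ) + k + 1)^2 ≤ 1 := by
      rw [div_le_one (by positivity)]
      have : (0:ℝ) ≤ (n:ℝ) + k := by positivity
      nlinarith
    push_cast; linarith

lemma aa_le (k n : ℕ) :
    aa (k+1) n ≤ 1 / ((n:ℝ) + 1)^2 / ((Nat.factorial k : ℕ) : ℝ)^2 := by
  induction k with
  | zero => simp [aa]
  | succ k ih =>
    rw [aa_succ, Nat.factorial_succ]
    calc _ ≤ (1 / ((n:ℝ) + 1)^2 / ((Nat.factorial k : ℕ) : ℝ)^2) * (1 / ((k:ℝ) + 1)^2) := by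
          gcongr
          push_cast
          have : (0:ℝ) ≤ n := by positivity
          linarith
      _ = _ := by push_cast; field_simp

lemma hdiff (k n : ℕ) : |hh (k+1) n - 4 * hh k 0| ≤ 4 * k + 4 := by
  have a1 := hh_nonneg (k+1) n
  have a2 := hh_nonneg k 0
  have a3 := hh_le (k+1) n
  have a4 := hh_le k 0
  have : (0:ℝ) ≤ k := by positivity
  push_cast at a3
  rw [abs_le]; constructor <;> linarith

lemma ww_pos (k : ℕ) : 0 < ww k := by
  have := cc_pos k
  unfold ww; positivity

lemma ee_le (k n : ℕ) : |ee k n| ≤ (4 * k + 4) / cc k * (1 / ((n:ℝ) + 1)^2) := by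
  unfold ee
  rw [abs_mul, abs_of_nonneg (mul_nonneg (ww_pos k).le (aa_nonneg _ _))]
  have hc := cc_pos k
  calc _ ≤ ww k * (1 / ((n:ℝ) + 1)^2 / ((Nat.factorial k : ℕ) : ℝ)^2) * (4 * k + 4) := by
        have := (ww_pos k).le
        gcongr
        · exact aa_le k n
        · exact hdiff k n
    _ = _ := by
      unfold ww
      have : ((Nat.factorial k : ℕ) : ℝ) ≠ 0 := by positivity
      field_simp

lemma summ2 : Summable (fun n : ℕ => 1 / ((n:ℝ) + 1)^2) := by
  have := (summable_nat_add_iff 1).2 hasSum_zeta_two.summable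
  simpa using this

lemma ee_summable (k : ℕ) : Summable (ee k) :=
  Summable.of_norm_bounded (summ2.mul_left _) (fun n => ee_le k n)

lemma gg_tendsto (k : ℕ) : Filter.Tendsto (gg k) Filter.atTop (nhds 0) := by
  have h1 : Filter.Tendsto (fun n : ℕ => 1 / ((n:ℝ) + 1)) Filter.atTop (nhds 0) :=
    tendsto_one_div_add_atTop_nhds_zero_nat
  have h2 := h1.const_mul (ww k / (2 * (2 * k + 1)) * (3 * k + 3) * (4 * k + 4))
  rw [mul_zero] at h2
  refine squeeze_zero_norm (fun n => ?_) h2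
  unfold gg
  have hw := (ww_pos k).le
  have ha := aa_nonneg (k+1) n
  rw [Real.norm_eq_abs, abs_mul, abs_of_nonneg (by positivity)]
  have haa : aa (k+1) n ≤ 1 / ((n:ℝ) + 1)^2 := by
    refine (aa_le k n).trans (div_le_self (by positivity) ?_)
    have : (1:ℝ) ≤ ((Nat.factorial k : ℕ) : ℝ) := by exact_mod_cast Nat.factorial_pos k
    nlinarith
  have hq : (2 * (n:ℝ) + 3 * k + 3) ≤ (3 * k + 3) * (n + 1) := by
    have : (0:ℝ) ≤ k * n := by positivity
    have : (0:ℝ) ≤ n := by positivity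
    nlinarith
  calc _ ≤ ww k / (2 * (2 * k + 1)) * ((3 * k + 3) * (n + 1)) * (1 / ((n:ℝ) + 1)^2) * (4 * k + 4) := by
        gcongr
        exact hdiff k n
    _ = _ := by field_simp

lemma aa_zero (k : ℕ) : aa k 0 = 1 / ((Nat.factorial k : ℕ) : ℝ)^2 := by
  induction k with
  | zero => simp [aa]
  | succ k ih =>
    rw [aa_succ, ih, Nat.factorial_succ]; push_cast; field_simp; ring

lemma gg_zero (k : ℕ) :
    gg k 0 = 3 / (((k:ℝ)+1)^4 * cc (k+1)) - 9 * (hh k 0 / (((k:ℝ)+1)^2 * cc (k+1))) := by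
  unfold gg
  rw [hh_succ, aa_zero, Nat.factorial_succ, cc_succ]
  unfold ww
  have := (cc_pos k).ne'
  have : ((Nat.factorial k : ℕ) : ℝ) ≠ 0 := by positivity
  push_cast
  rw [zero_add, mul_zero, zero_add]
  field_simp
  ring

lemma D_step (k : ℕ) : (∑' n, ee k n) - (∑' n, ee (k+1) n) = gg k 0 := by
  rw [← (ee_summable k).tsum_sub (ee_summable (k+1))]
  have h1 := ((ee_summable k).sub (ee_summable (k+1))).hasSum.tendsto_sum_nat
  refine tendsto_nhds_unique h1 ?_
  have h2 : ∀ N, ∑ n ∈ range N, (ee k n - ee (k+1) n) = gg k 0 - gg k N := by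
    intro N
    simp only [tele]
    exact sum_range_sub' _ _
  simp only [h2]
  simpa using (gg_tendsto k).const_sub (gg k 0)

lemma D_zero : ∑' n, ee 0 n = π^4 / 90 := by
  have h := (hasSum_nat_add_iff' 1).2 hasSum_zeta_four
  simp at h
  rw [← h.tsum_eq]
  congr 1; ext n
  simp [ee, ww, cc, aa, hh]
  rw [← mul_inv]; congr 1; ring

lemma D_tendsto : Filter.Tendsto (fun k => ∑' n, ee k n) Filter.atTop (nhds 0) := by
  have h := (tend_aux 4 4).mul_const (∑' n : ℕ, 1 / ((n:ℝ) + 1)^2)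
  rw [zero_mul] at h
  refine squeeze_zero_norm (fun k => ?_) h
  rw [← tsum_mul_left]
  exact tsum_of_norm_bounded (summ2.mul_left _).hasSum (fun n => ee_le k n)

/-! Part 1 : arcsin series -/

lemma second (F F' F'' : ℝ → ℝ) (b ε : ℝ) (hb : b ≤ 1)
    (h1 : ∀ x, HasDerivAt F (F' x) x) (h2 : ∀ x, HasDerivAt F' (F'' x) x)
    (z1 : F 0 = 0) (z2 : F' 0 = 0) (hε : ∀ x ∈ Set.Icc 0 b, |F'' x| ≤ ε) :
    ∀ x ∈ Set.Icc 0 b, |F x| ≤ ε := by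
  have key : ∀ (G G' : ℝ → ℝ), (∀ x, HasDerivAt G (G' x) x) → G 0 = 0 →
      (∀ x ∈ Set.Icc 0 b, |G' x| ≤ ε) → ∀ x ∈ Set.Icc 0 b, |G x| ≤ ε := by
    intro G G' hG z hb' x hx
    have h0 : (0:ℝ) ∈ Set.Icc 0 b := ⟨le_rfl, hx.1.trans hx.2⟩
    have := (convex_Icc 0 b).norm_image_sub_le_of_norm_hasDerivWithin_le
      (fun y _ => (hG y).hasDerivWithinAt) hb' h0 hx
    rw [z, sub_zero, sub_zero, Real.norm_eq_abs, Real.norm_eq_abs, abs_of_nonneg hx.1] at this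
    have hε0 := (abs_nonneg _).trans (hb' 0 h0)
    nlinarith [hx.1, hx.2]
  exact key F F' h1 z1 (key F' F'' h2 z2 hε)

def ss (k : ℕ) (t : ℝ) : ℝ := (2 * sin t)^(2*k+2) / (((k:ℝ)+1)^2 * cc (k+1))
def ss' (k : ℕ) (t : ℝ) : ℝ :=
  (2*k+2) * (2 * sin t)^(2*k+1) * (2 * cos t) / (((k:ℝ)+1)^2 * cc (k+1))
def uu (k : ℕ) (t : ℝ) : ℝ := (2 * sin t)^(2*k) / cc k

lemma ss_deriv (k : ℕ) (t : ℝ) : HasDerivAt (ss k) (ss' k t) t := by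
  have h := ((((hasDerivAt_sin t).const_mul 2).pow (2*k+2)).div_const (((k:ℝ)+1)^2 * cc (k+1)))
  refine h.congr_deriv ?_
  unfold ss'
  push_cast
  simp

lemma ss'_deriv (k : ℕ) (t : ℝ) : HasDerivAt (ss' k) (4 * (uu k t - uu (k+1) t)) t := by
  have h := (((((hasDerivAt_sin t).const_mul 2).pow (2*k+1)).const_mul ((2:ℝ)*k+2)).mul
    ((hasDerivAt_cos t).const_mul 2)).div_const (((k:ℝ)+1)^2 * cc (k+1))
  refine h.congr_deriv ?_
  unfold uu
  have hc := (cc_pos k).ne'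
  rw [cc_succ]
  simp only [Pi.pow_apply, Nat.add_sub_cancel]
  have e : cos t * cos t = 1 - sin t * sin t := by
    have := sin_sq_add_cos_sq t; linarith
  push_cast
  have e1 : (2 * sin t)^(2*(k+1)) = (2 * sin t)^(2*k) * (4 * (sin t * sin t)) := by ring
  have e2 : (2 * sin t)^(2*k+1) = (2 * sin t)^(2*k) * (2 * sin t) := by ring
  rw [e1, e2]
  generalize (2 * sin t)^(2*k) = X
  field_simp
  have e3 : cos t ^ 2 = 1 - sin t ^ 2 := by linarith [sin_sq_add_cos_sq t]
  ring_nf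
  rw [e3]
  ring

lemma uu_bd (k : ℕ) (t : ℝ) (ht : t ∈ Set.Icc 0 (π/6)) : 0 ≤ uu k t ∧ uu k t ≤ 1 / cc k := by
  have h0 : 0 ≤ sin t := sin_nonneg_of_nonneg_of_le_pi ht.1 (by linarith [ht.2, pi_pos])
  have h1 : sin t ≤ 1 / 2 := by
    rw [← sin_pi_div_six]
    exact sin_le_sin_of_le_of_le_pi_div_two (by linarith [ht.1, pi_pos]) (by linarith [pi_pos]) ht.2
  have hc := cc_pos k
  unfold uu
  refine ⟨by positivity, ?_⟩
  gcongr
  exact pow_le_one₀ (by positivity) (by linarith)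

def PP (N : ℕ) (t : ℝ) : ℝ := ∑ k ∈ range N, ss k t
def TT (N : ℕ) (t : ℝ) : ℝ := ∑ k ∈ range N, hh k 0 * ss k t

lemma ss_zero (k : ℕ) : ss k 0 = 0 := by simp [ss]
lemma ss'_zero (k : ℕ) : ss' k 0 = 0 := by simp [ss']

lemma P_tele (N : ℕ) (t : ℝ) : ∑ k ∈ range N, 4 * (uu k t - uu (k+1) t) = 4 - 4 * uu N t := by
  rw [← mul_sum, sum_range_sub']
  simp [uu, cc]; ring

lemma T_tele (N : ℕ) (t : ℝ) : ∑ k ∈ range N, hh k 0 * (4 * (uu k t - uu (k+1) t))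
    = 4 * PP N t - 4 * (hh N 0 * uu N t) := by
  induction N with
  | zero => simp [PP, hh]
  | succ N ih =>
    rw [sum_range_succ, ih]
    have h : ss N t = 1 / (((0:ℕ):ℝ) + N + 1)^2 * uu (N+1) t := by
      have := (cc_pos (N+1)).ne'
      unfold ss uu
      push_cast
      rw [zero_add]
      field_simp
      ring
    have h2 : PP (N+1) t = PP N t + ss N t := by simp [PP, sum_range_succ]
    rw [h2, h, hh_succ]
    ring

lemma pi6 : π / 6 ≤ 1 := by linarith [pi_le_four]

lemma P_bd (N : ℕ) : ∀ t ∈ Set.Icc 0 (π/6), |PP N t - 2 * t^2| ≤ 4 / cc N := by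
  refine second (fun t => PP N t - 2 * t^2) (fun t => (∑ k ∈ range N, ss' k t) - 4 * t)
    (fun t => (∑ k ∈ range N, 4 * (uu k t - uu (k+1) t)) - 4) _ _ pi6 ?_ ?_ ?_ ?_ ?_
  · intro x
    refine (HasDerivAt.fun_sum (fun k _ => ss_deriv k x)).sub ?_
    refine ((hasDerivAt_pow 2 x).const_mul 2).congr_deriv ?_
    push_cast; ring
  · intro x
    refine (HasDerivAt.fun_sum (fun k _ => ss'_deriv k x)).sub ?_
    exact ((hasDerivAt_id x).const_mul 4).congr_deriv (by ring)
  · simp [PP, ss_zero]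
  · simp [ss'_zero]
  · intro t ht
    have := uu_bd N t ht
    have e : 4 / cc N = 4 * (1 / cc N) := by ring
    simp only [P_tele]
    rw [abs_le, e]; constructor <;> linarith

lemma T_bd (N : ℕ) : ∀ t ∈ Set.Icc 0 (π/6), |TT N t - 2 / 3 * t^4| ≤ (4 * N + 16) / cc N := by
  refine second (fun t => TT N t - 2 / 3 * t^4)
    (fun t => (∑ k ∈ range N, hh k 0 * ss' k t) - 8 / 3 * t^3)
    (fun t => (∑ k ∈ range N, hh k 0 * (4 * (uu k t - uu (k+1) t))) - 8 * t^2) _ _ pi6 ?_ ?_ ?_ ?_ ?_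
  · intro x
    refine (HasDerivAt.fun_sum (fun k _ => (ss_deriv k x).const_mul _)).sub ?_
    refine ((hasDerivAt_pow 4 x).const_mul (2/3)).congr_deriv ?_
    push_cast; ring
  · intro x
    refine (HasDerivAt.fun_sum (fun k _ => (ss'_deriv k x).const_mul _)).sub ?_
    refine ((hasDerivAt_pow 3 x).const_mul (8/3)).congr_deriv ?_
    push_cast; ring
  · simp [TT, ss_zero]
  · simp [ss'_zero]
  · intro t ht
    have h1 := uu_bd N t ht
    have h2 := P_bd N t ht
    have h3 := hh_nonneg N 0
    have h4 := hh_le N 0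
    have h5 : hh N 0 * uu N t ≤ N * (1 / cc N) := mul_le_mul h4 h1.2 h1.1 (by positivity)
    have h6 : 0 ≤ hh N 0 * uu N t := mul_nonneg h3 h1.1
    have h7 : 0 ≤ 1 / cc N := (h1.1).trans h1.2
    have h8 : 0 ≤ N * (1 / cc N) := by positivity
    have e : 4 / cc N = 4 * (1 / cc N) := by ring
    have e' : (4 * N + 16) / cc N = 4 * (N * (1 / cc N)) + 16 * (1 / cc N) := by ring
    simp only [T_tele]
    rw [e, abs_le] at h2
    rw [abs_le, e']; constructor <;> linarith [h2.1, h2.2]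

lemma T_tendsto : Filter.Tendsto
    (fun N => ∑ k ∈ range N, hh k 0 / (((k:ℝ)+1)^2 * cc (k+1))) Filter.atTop
    (nhds (2 / 3 * (π/6)^4)) := by
  rw [tendsto_iff_norm_sub_tendsto_zero]
  refine squeeze_zero (fun _ => norm_nonneg _) (fun N => ?_) (tend_aux 4 16)
  have h := T_bd N (π/6) ⟨by positivity, le_rfl⟩
  have e : TT N (π/6) = ∑ k ∈ range N, hh k 0 / (((k:ℝ)+1)^2 * cc (k+1)) := by
    unfold TT
    refine sum_congr rfl (fun k _ => ?_)
    unfold ss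
    rw [sin_pi_div_six]
    norm_num
    field_simp
  rw [e] at h
  exact h

lemma fin_sum (N : ℕ) : ∑ k ∈ range N, 1 / (((k:ℝ)+1)^4 * cc (k+1)) =
    (1/3) * ((∑' n, ee 0 n) - (∑' n, ee N n)) +
      3 * ∑ k ∈ range N, hh k 0 / (((k:ℝ)+1)^2 * cc (k+1)) := by
  induction N with
  | zero => simp
  | succ N ih =>
    rw [sum_range_succ, ih, sum_range_succ]
    have h := D_step N
    rw [gg_zero] at h
    have e : 3 / (((N:ℝ)+1)^4 * cc (N+1)) = 3 * (1 / (((N:ℝ)+1)^4 * cc (N+1))) := by ring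
    rw [e] at h
    linarith

end

theorem stmt_15 : (∑' i : ℕ, (1:ℝ) / (((i:ℝ)+1)^4 * ((Nat.choose (2*(i+1)) (i+1)) : ℝ))) = 17 * Real.pi^4 / 3240 := by
  have h : HasSum (fun k : ℕ => 1 / (((k:ℝ)+1)^4 * cc (k+1))) (17 * Real.pi^4 / 3240) := by
    rw [hasSum_iff_tendsto_nat_of_nonneg
      (fun k => by have := cc_pos (k+1); positivity)]
    simp only [fin_sum]
    have := ((D_tendsto.const_sub (∑' n, ee 0 n)).const_mul (1/3)).add (T_tendsto.const_mul 3)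
    convert this using 2
    rw [D_zero]; ring
  exact h.tsum_eq
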